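/- Let R be a commutative ring, (f_1, …, f_r) a sequence in R, and (n_1, …, n_r) a sequence of positive integers. Then, in the homotopy category K(R) of R-complexes, the Koszul complex K_•(f_1^{n_1}, …, f_r^{n_r}) belongs to {K_•(f_1, …, f_r)}[0,0]. -/

import Mathlib

/-!
Koszul complexes (cohomologically indexed, over the category of `R`-modules).
For `f ∈ R` and a complex `E`, the tensor product `K_•(f) ⊗_R E` is (naturally isomorphic
to) the mapping cone of multiplication by `f` on `E`; accordingly the tensor product
`K_•(f₁, …, f_r) ⊗_R P` is defined as an iterated mapping cone, and the Koszul complex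
`K_•(f₁, …, f_r)` is the case `P = R` (the ring placed in degree `0`).
-/

open CategoryTheory

universe u

noncomputable section

variable (R : Type u) [CommRing R]

/-- The complex consisting of `R` placed in degree `0`. -/
def singleR : CochainComplex (ModuleCat.{u} R) ℤ :=
  (HomologicalComplex.single (ModuleCat.{u} R) (ComplexShape.up ℤ) 0).obj (ModuleCat.of R R)

/-- `koszulTensor R l P` is the tensor product `K_•(l) ⊗_R P` of the Koszul complex on the
list `l` with the complex `P`, defined as the iterated mapping cone of multiplication by
the elements of `l` on `P`. -/
def koszulTensor : List R → CochainComplex (ModuleCat.{u} R) ℤ →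
    CochainComplex (ModuleCat.{u} R) ℤ
  | [], P => P
  | f :: fs, P => CochainComplex.mappingCone ((f • 𝟙 (koszulTensor fs P)))

/-- The Koszul complex `K_•(l)` on a list `l` of elements of `R`. -/
def koszul (l : List R) : CochainComplex (ModuleCat.{u} R) ℤ := koszulTensor R l (singleR R)

/-- The canonical map `P = R ⊗_R P ⟶ K_•(l) ⊗_R P` induced by the map of complexes
`R → K_•(l)` which is the identity in degree `0`. -/
def koszulTensorUnit : (l : List R) → (P : CochainComplex (ModuleCat.{u} R) ℤ) →
    (P ⟶ koszulTensor R l P)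
  | [], P => 𝟙 P
  | f :: fs, P =>
      koszulTensorUnit fs P ≫ CochainComplex.mappingCone.inr (f • 𝟙 (koszulTensor R fs P))

/-- A module `M` is `I`-torsion if every element of `M` is annihilated by some power of
the ideal `I`. -/
def IsIdealTorsion (I : Ideal R) (M : Type u) [AddCommGroup M] [Module R M] : Prop :=
  ∀ x : M, ∃ k : ℕ, ∀ a ∈ I ^ k, a • x = 0

end

/-!
Common setup: for a triangulated category `T`, a class of objects `S` and integers
`m ≤ n`, `SmnMem S m n E` expresses that `E` belongs to `S[m,n]`, the smallest full
subcategory of `T` containing `0`, containing `E⟦-ℓ⟧` (that is, `E[-ℓ]`) for every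
`E ∈ S` and every integer `ℓ` with `m ≤ ℓ ≤ n`, and such that for every distinguished
triangle `E ⟶ F ⟶ G ⟶ E⟦1⟧`, if `E` and `G` lie in it then so does `F`.
(Membership in a full subcategory is determined by the class of objects.)
-/

open CategoryTheory CategoryTheory.Limits CategoryTheory.Pretriangulated

universe w v v₁ u₁

/-- Membership in the subcategory `S[m,n]` of Lipman–Neeman, Definition 5.1. -/
inductive SmnMem {T : Type u} [Category.{v} T] [HasZeroObject T] [Preadditive T]
    [HasShift T ℤ] [∀ n : ℤ, (shiftFunctor T n).Additive] [Pretriangulated T]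
    (S : Set T) (m n : ℤ) : T → Prop
  | zero (Z : T) (hZ : IsZero Z) : SmnMem S m n Z
  | shift (E : T) (hE : E ∈ S) (ℓ : ℤ) (h₁ : m ≤ ℓ) (h₂ : ℓ ≤ n) : SmnMem S m n (E⟦(-ℓ : ℤ)⟧)
  | ext (Tr : Triangle T) (hTr : Tr ∈ distTriang T)
      (h₁ : SmnMem S m n Tr.obj₁) (h₃ : SmnMem S m n Tr.obj₃) : SmnMem S m n Tr.obj₂

section Triangulated

open scoped ZeroObject

variable {T : Type u} [Category.{v} T] [HasZeroObject T] [Preadditive T]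
  [HasShift T ℤ] [∀ n : ℤ, (shiftFunctor T n).Additive] [Pretriangulated T]

lemma SmnMem.of_iso {S : Set T} {m n : ℤ} {X Y : T} (h : SmnMem S m n X) (e : X ≅ Y) :
    SmnMem S m n Y := by
  refine .ext (Triangle.mk e.hom (0 : Y ⟶ (0 : T)) 0) ?_ h (.zero _ (isZero_zero T))
  refine isomorphic_distinguished _ (contractible_distinguished X) _
    (Triangle.isoMk _ _ (Iso.refl X) e.symm (Iso.refl _) ?_ ?_ ?_) <;>
    simp [Triangle.mk, contractibleTriangle]

lemma SmnMem.of_mem {S : Set T} {m n : ℤ} {X : T} (hX : X ∈ S) (hm : m ≤ 0) (hn : 0 ≤ n) :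
    SmnMem S m n X :=
  (SmnMem.shift X hX 0 hm hn).of_iso ((shiftFunctorZero' T _ neg_zero).app X)

lemma SmnMem.trans {S S' : Set T} {X : T} (h : SmnMem S 0 0 X)
    (hS : ∀ Y ∈ S, SmnMem S' 0 0 Y) : SmnMem S' 0 0 X := by
  induction h with
  | zero Z hZ => exact .zero Z hZ
  | shift E hE ℓ h₁ h₂ =>
    exact (hS E hE).of_iso ((shiftFunctorZero' T _ (by lia)).app E).symm
  | ext Tr hTr _ _ h₁ h₃ => exact .ext Tr hTr h₁ h₃

end Triangulated

lemma CochainComplex.HomComplex.Cochain.ofHom_smul {C : Type u₁} [Category.{v₁} C]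
    [Preadditive C] {R : Type*} [Ring R] [Linear R C] {K L : CochainComplex C ℤ}
    (r : R) (φ : K ⟶ L) : Cochain.ofHom (r • φ) = r • Cochain.ofHom φ := by
  ext p
  simp

namespace CochainComplex.mappingCone

open HomComplex

variable {C : Type u₁} [Category.{v₁} C] [Preadditive C] [HasBinaryBiproducts C]

/-- A commutative square whose horizontal maps are isomorphisms induces an isomorphism of
mapping cones. -/
noncomputable def mapIso {K₁ L₁ K₂ L₂ : CochainComplex C ℤ} (φ₁ : K₁ ⟶ L₁) (φ₂ : K₂ ⟶ L₂)
    (a : K₁ ≅ K₂) (b : L₁ ≅ L₂) (comm : φ₁ ≫ b.hom = a.hom ≫ φ₂) :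
    mappingCone φ₁ ≅ mappingCone φ₂ where
  hom := map φ₁ φ₂ a.hom b.hom comm
  inv := map φ₂ φ₁ a.inv b.inv (by rw [Iso.eq_inv_comp, ← reassoc_of% comm]; simp)
  hom_inv_id := by
    rw [← map_comp, ← map_id]; congr 1 <;> simp
  inv_hom_id := by
    rw [← map_comp, ← map_id]; congr 1 <;> simp

variable {R : Type*} [CommRing R] [Linear R C]

/-- The canonical map exchanging the order in which the mapping cones of multiplication by
`f` and by `g` on `K` are formed; it is `-1` on the summand shifted twice. -/
noncomputable def smulSwap (f g : R) (K : CochainComplex C ℤ) :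
    mappingCone (f • 𝟙 (mappingCone (g • 𝟙 K))) ⟶
      mappingCone (g • 𝟙 (mappingCone (f • 𝟙 K))) :=
  desc _
    (descCochain (g • 𝟙 K)
      (-(inl (f • 𝟙 K)).comp (inl (g • 𝟙 (mappingCone (f • 𝟙 K)))) (show -1 + -1 = -2 by rfl))
      ((inl (f • 𝟙 K)).comp (Cochain.ofHom (inr (g • 𝟙 (mappingCone (f • 𝟙 K)))))
        (add_zero (-1))) (by rfl))
    (map (g • 𝟙 K) (g • 𝟙 (mappingCone (f • 𝟙 K))) (inr _) (inr _) (by simp))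
    (by
      rw [δ_descCochain _ _ _ _ 0 (by rfl), ext_cochain_from_iff _ (-1) 0 (by rfl)]
      constructor
      · simp only [map, δ_neg, δ_inl, Cochain.ofHom_smul,
          δ_comp _ _ (show (-1 : ℤ) + -1 = -2 by rfl) 0 0 (-1) (by rfl) (by rfl) (by rfl)]
        ext p q hpq
        simp [Cochain.ofHom_smul]
      · simp [map, Cochain.ofHom_smul, Cochain.comp_smul, Cochain.smul_comp])

lemma smulSwap_smulSwap (f g : R) (K : CochainComplex C ℤ) :
    smulSwap f g K ≫ smulSwap g f K = 𝟙 _ := by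
  ext p
  rw [ext_from_iff _ _ _ rfl, ext_from_iff _ (p + 1 + 1) _ rfl, ext_from_iff _ (p + 1) _ rfl]
  refine ⟨⟨?_, ?_⟩, ?_, ?_⟩ <;> simp [smulSwap, map]
  simp [Cochain.comp_v _ _ (show (-1 : ℤ) + -1 = -2 by rfl) (p + 1 + 1) (p + 1) p
    (by lia) (by lia)]

/-- Mapping cones of multiplication by two ring elements can be interchanged. -/
noncomputable def smulSwapIso (f g : R) (K : CochainComplex C ℤ) :
    mappingCone (f • 𝟙 (mappingCone (g • 𝟙 K))) ≅
      mappingCone (g • 𝟙 (mappingCone (f • 𝟙 K))) where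
  hom := smulSwap f g K
  inv := smulSwap g f K
  hom_inv_id := smulSwap_smulSwap f g K
  inv_hom_id := smulSwap_smulSwap g f K

end CochainComplex.mappingCone

section Koszul

open CochainComplex HomotopyCategory

variable (R : Type u) [CommRing R]

/-- The first factor of a Koszul complex may be moved to the coefficients. -/
noncomputable def koszulTensorConsIso (f : R) (P : CochainComplex (ModuleCat.{u} R) ℤ) :
    (l : List R) → (koszulTensor R (f :: l) P ≅ koszulTensor R l (mappingCone (f • 𝟙 P)))
  | [] => Iso.refl _
  | g :: gs =>
    mappingCone.smulSwapIso f g (koszulTensor R gs P) ≪≫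
      mappingCone.mapIso _ _ (koszulTensorConsIso f P gs) (koszulTensorConsIso f P gs) (by simp)

lemma smnMem_mappingCone_pow_smul (f : R) (P : CochainComplex (ModuleCat.{u} R) ℤ) {n : ℕ}
    (hn : 0 < n) :
    SmnMem {(quotient (ModuleCat.{u} R) (ComplexShape.up ℤ)).obj
        (mappingCone (f • 𝟙 P))} 0 0
      ((quotient (ModuleCat.{u} R) (ComplexShape.up ℤ)).obj
        (mappingCone (f ^ n • 𝟙 P))) := by
  induction n, hn using Nat.le_induction with
  | base => exact .of_mem (by simp) le_rfl le_rfl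
  | succ n hn ih =>
    have comm : (f ^ n • 𝟙 P) ≫ (f • 𝟙 P) = f ^ (n + 1) • 𝟙 P := by
      simp [smul_smul, pow_succ']
    let Q := quotient (ModuleCat.{u} R) (ComplexShape.up ℤ)
    have comm' : Q.map (f ^ n • 𝟙 P) ≫ Q.map (f • 𝟙 P) = Q.map (f ^ (n + 1) • 𝟙 P) := by
      rw [← Functor.map_comp, comm]
    have o := Triangulated.someOctahedron comm'
      (mappingCone_triangleh_distinguished (f ^ n • 𝟙 P))
      (mappingCone_triangleh_distinguished (f • 𝟙 P))
      (mappingCone_triangleh_distinguished (f ^ (n + 1) • 𝟙 P))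
    exact .ext _ o.mem ih (.of_mem rfl le_rfl le_rfl)

lemma smnMem_koszulTensor_pow {l l' : List R}
    (h : List.Forall₂ (fun a b => ∃ n : ℕ, 0 < n ∧ b = a ^ n) l l')
    (P : CochainComplex (ModuleCat.{u} R) ℤ) :
    SmnMem {(quotient (ModuleCat.{u} R) (ComplexShape.up ℤ)).obj
        (koszulTensor R l P)} 0 0
      ((quotient (ModuleCat.{u} R) (ComplexShape.up ℤ)).obj
        (koszulTensor R l' P)) := by
  induction h generalizing P with
  | nil => exact .of_mem rfl le_rfl le_rfl
  | @cons a b l l' hab _ ih =>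
    obtain ⟨n, hn, rfl⟩ := hab
    refine (smnMem_mappingCone_pow_smul R a (koszulTensor R l' P) hn).trans ?_
    rintro _ rfl
    refine .of_iso (.trans (ih (mappingCone (a • 𝟙 P))) ?_)
      ((quotient _ _).mapIso (koszulTensorConsIso R a P l').symm)
    rintro _ rfl
    exact .of_iso (.of_mem rfl le_rfl le_rfl)
      ((quotient _ _).mapIso (koszulTensorConsIso R a P l))

end Koszul

open HomotopyCategory in
/-- **Example 5.6 of Lipman–Neeman.** For a commutative ring `R`, a sequence
`(f₁, …, f_r)` in `R` and positive integers `(n₁, …, n_r)`, the Koszul complex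
`K_•(f₁^{n₁}, …, f_r^{n_r})` belongs to `{K_•(f₁, …, f_r)}[0,0]` in the homotopy
category `K(R)`. -/
theorem statement_12 (R : Type u) [CommRing R] (r : ℕ) (f : Fin r → R)
    (n : Fin r → ℕ) (hn : ∀ i, 0 < n i) :
    SmnMem
      {(HomotopyCategory.quotient (ModuleCat.{u} R) (ComplexShape.up ℤ)).obj
        (koszul R (List.ofFn f))} 0 0
      ((HomotopyCategory.quotient (ModuleCat.{u} R) (ComplexShape.up ℤ)).obj
        (koszul R (List.ofFn fun i => f i ^ n i))) := by
  refine smnMem_koszulTensor_pow R ?_ _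
  rw [List.forall₂_iff_get]
  refine ⟨by simp, fun i h₁ h₂ => ?_⟩
  simp only [List.get_ofFn]
  exact ⟨_, hn _, rfl⟩
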